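/- Let A be a symmetric skew left brace. Then ε(u,v) ∈ Ann_{s-r}(A) for all ε ∈ X, all integers s ≥ r ≥ 1, all u ∈ Ann_s(A) and all v ∈ Γ_r(A); consequently A belongs to the class I_n for every n ≥ 1. -/

import Mathlib

set_option linter.unusedVariables false

universe u v

/-- A skew left brace: a carrier with two group structures `(A,·)` (written `dmul`) and
`(A,∘)` (written `cmul`) sharing the same identity `ident`, satisfying
`a ∘ (b · c) = (a ∘ b) · a⁻¹ · (a ∘ c)`. -/
class SkewBrace (A : Type u) where
  dmul : A → A → A
  ident : A
  dinv : A → A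
  cmul : A → A → A
  cinv : A → A
  dmul_assoc : ∀ a b c : A, dmul (dmul a b) c = dmul a (dmul b c)
  ident_dmul : ∀ a : A, dmul ident a = a
  dmul_ident : ∀ a : A, dmul a ident = a
  dinv_dmul : ∀ a : A, dmul (dinv a) a = ident
  dmul_dinv : ∀ a : A, dmul a (dinv a) = ident
  cmul_assoc : ∀ a b c : A, cmul (cmul a b) c = cmul a (cmul b c)
  ident_cmul : ∀ a : A, cmul ident a = a
  cmul_ident : ∀ a : A, cmul a ident = a
  cinv_cmul : ∀ a : A, cmul (cinv a) a = ident
  cmul_cinv : ∀ a : A, cmul a (cinv a) = ident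
  compat : ∀ a b c : A, cmul a (dmul b c) = dmul (dmul (cmul a b) (dinv a)) (cmul a c)

namespace SkewBrace

variable {A : Type u} [SkewBrace A]

/-- The lambda map `λ_a(b) = a⁻¹ · (a ∘ b)`. -/
def lam (a b : A) : A := dmul (dinv a) (cmul a b)

/-- The star operation `a * b = λ_a(b) · b⁻¹`. -/
def bstar (a b : A) : A := dmul (lam a b) (dinv b)

/-- The dot commutator `[a,b]· = a · b · a⁻¹ · b⁻¹`. -/
def dcomm (a b : A) : A := dmul (dmul (dmul a b) (dinv a)) (dinv b)

/-- The circle commutator `[a,b]∘ = a ∘ b ∘ ā ∘ b̄`. -/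
def ccomm (a b : A) : A := cmul (cmul (cmul a b) (cinv a)) (cinv b)

/-- Membership in the subgroup of `(A,·)` generated by a subset. -/
inductive dclosure (S : Set A) : A → Prop
  | mem {x : A} : x ∈ S → dclosure S x
  | one : dclosure S ident
  | mul {x y : A} : dclosure S x → dclosure S y → dclosure S (dmul x y)
  | inv {x : A} : dclosure S x → dclosure S (dinv x)

/-- The subgroup of `(A,·)` generated by a subset, as a set. -/
def dcl (S : Set A) : Set A := {x | dclosure S x}

/-- Membership in the subgroup of `(A,∘)` generated by a subset. -/
inductive cclosure (S : Set A) : A → Prop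
  | mem {x : A} : x ∈ S → cclosure S x
  | one : cclosure S ident
  | mul {x y : A} : cclosure S x → cclosure S y → cclosure S (cmul x y)
  | inv {x : A} : cclosure S x → cclosure S (cinv x)

/-- The subgroup of `(A,∘)` generated by a subset, as a set. -/
def ccl (S : Set A) : Set A := {x | cclosure S x}

/-- The set `{x * y : x ∈ I, y ∈ J}` (star values). -/
def starSet (I J : Set A) : Set A := {x | ∃ a ∈ I, ∃ b ∈ J, x = bstar a b}

/-- The set of dot commutators `[a,b]·` with `a ∈ I`, `b ∈ J`. -/
def dcommSet (I J : Set A) : Set A := {x | ∃ a ∈ I, ∃ b ∈ J, x = dcomm a b}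

/-- The set of circle commutators `[a,b]∘` with `a ∈ I`, `b ∈ J`. -/
def ccommSet (I J : Set A) : Set A := {x | ∃ a ∈ I, ∃ b ∈ J, x = ccomm a b}

/-- The lower central series `Γ_n(A)` of the skew brace `A` (`Gamma A n = Γ_n(A)` for `n ≥ 1`):
`Γ₁(A) = A` and `Γ_n(A) = ⟨A * Γ_{n-1}(A), Γ_{n-1}(A) * A, [A,Γ_{n-1}(A)]·⟩·`. -/
def Gamma (A : Type u) [SkewBrace A] : ℕ → Set A
  | 0 => Set.univ
  | 1 => Set.univ
  | (n+2) =>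
      dcl (starSet Set.univ (Gamma A (n+1)) ∪ starSet (Gamma A (n+1)) Set.univ ∪
        dcommSet Set.univ (Gamma A (n+1)))

/-- The lower central series `γ_n(A,∘)` of the group `(A,∘)`
(`gammaCirc A n = γ_n(A,∘)` for `n ≥ 1`). -/
def gammaCirc (A : Type u) [SkewBrace A] : ℕ → Set A
  | 0 => Set.univ
  | 1 => Set.univ
  | (n+2) => ccl (ccommSet (gammaCirc A (n+1)) Set.univ)

/-- The series `Γ̄_n(A)`: `Γ̄₁(A) = A`, `Γ̄_n(A) = ⟨A * Γ̄_{n-1}(A), [A, Γ̄_{n-1}(A)]·⟩·`. -/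
def GammaBar (A : Type u) [SkewBrace A] : ℕ → Set A
  | 0 => Set.univ
  | 1 => Set.univ
  | (n+2) =>
      dcl (starSet Set.univ (GammaBar A (n+1)) ∪ dcommSet Set.univ (GammaBar A (n+1)))

/-- The annihilator series: `AnnS A n = Ann_n(A)`, with `Ann_0(A) = 1` and
`Ann_n(A) = {a | a*b, b*a, [a,b]· ∈ Ann_{n-1}(A) for all b}`. -/
def AnnS (A : Type u) [SkewBrace A] : ℕ → Set A
  | 0 => {ident}
  | (n+1) => {a | ∀ b : A, bstar a b ∈ AnnS A n ∧ bstar b a ∈ AnnS A n ∧ dcomm a b ∈ AnnS A n}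

/-- The alphabet `X = {γ·, γ̄·, *, *̄}` of brace commutator symbols. -/
inductive BWord : Type
  | g | gbar | s | sbar

/-- Evaluation of a single symbol of `X`. -/
def evalX : BWord → A → A → A
  | BWord.g => dcomm
  | BWord.gbar => fun a b => dcomm b a
  | BWord.s => bstar
  | BWord.sbar => fun a b => bstar b a

/-- `evalW e a n` is the value `m(a₀ a₁ ⋯ a_n)` of the degree-`n` brace commutator word
`m = (e 0)(e 1)⋯(e (n-1))` on the arguments `a 0, …, a n`:
`m(a₀ ⋯ a_n) = (e 0)(a₀, (e 1)(a₁, …, (e (n-1))(a_{n-1}, a_n)⋯))`. -/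
def evalW : (ℕ → BWord) → (ℕ → A) → ℕ → A
  | _, a, 0 => a 0
  | e, a, (n+1) => evalX (e 0) (a 0) (evalW (fun i => e (i+1)) (fun i => a (i+1)) n)

/-- `Asub A t = A_{(t)}`, the subgroup of `(A,·)` generated by all values of brace commutator
words of degree `≥ t`. -/
def Asub (A : Type u) [SkewBrace A] (t : ℕ) : Set A :=
  dcl {x | ∃ s : ℕ, t ≤ s ∧ ∃ (e : ℕ → BWord) (a : ℕ → A), x = evalW e a s}

/-- `Sset A r = S_r(A)`, the set of all values of brace commutator words of degree exactly `r`
(`S_0(A) = A`). -/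
def Sset (A : Type u) [SkewBrace A] (r : ℕ) : Set A :=
  {x | ∃ (e : ℕ → BWord) (a : ℕ → A), x = evalW e a r}

/-- `cosetRel I a b` says that `b` lies in the coset `I · a`. -/
def cosetRel (I : Set A) (a b : A) : Prop := ∃ c ∈ I, b = dmul c a

/-- The class `I_n`: the maps `φ_m : (A/Ann_n(A))^{n+1} → A_{(n)}`,
`(Ann_n(A)a₁, …, Ann_n(A)a_{n+1}) ↦ m(a₁⋯a_{n+1})`, are well defined for every word `m` of
degree `n`. -/
def InClass (A : Type u) [SkewBrace A] (n : ℕ) : Prop :=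
  ∀ (e : ℕ → BWord) (a b : ℕ → A),
    (∀ i : ℕ, i ≤ n → cosetRel (AnnS A n) (a i) (b i)) →
    evalW e b n = evalW e a n

/-- A skew left brace `(A,·,∘)` is symmetric if `(A,∘,·)` is also a skew left brace, i.e.
`a · (b ∘ c) = (a · b) ∘ ā ∘ (a · c)`. -/
def IsSymmetric (A : Type u) [SkewBrace A] : Prop :=
  ∀ a b c : A, dmul a (cmul b c) = cmul (cmul (dmul a b) (cinv a)) (dmul a c)

/-- A sub-skew brace: a subset which is a subgroup of both `(A,·)` and `(A,∘)`. -/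
structure IsSubBrace (A : Type u) [SkewBrace A] (S : Set A) : Prop where
  ident_mem : ident ∈ S
  dmul_mem : ∀ {x y : A}, x ∈ S → y ∈ S → dmul x y ∈ S
  dinv_mem : ∀ {x : A}, x ∈ S → dinv x ∈ S
  cmul_mem : ∀ {x y : A}, x ∈ S → y ∈ S → cmul x y ∈ S
  cinv_mem : ∀ {x : A}, x ∈ S → cinv x ∈ S

/-- An ideal of a skew brace: a subgroup of `(A,·)`, normal in `(A,·)` and `(A,∘)`,
and invariant under all `λ_a`. -/
structure IsIdeal (A : Type u) [SkewBrace A] (I : Set A) : Prop where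
  ident_mem : ident ∈ I
  dmul_mem : ∀ {x y : A}, x ∈ I → y ∈ I → dmul x y ∈ I
  dinv_mem : ∀ {x : A}, x ∈ I → dinv x ∈ I
  dconj_mem : ∀ (a : A) {x : A}, x ∈ I → dmul (dmul a x) (dinv a) ∈ I
  cconj_mem : ∀ (a : A) {x : A}, x ∈ I → cmul (cmul a x) (cinv a) ∈ I
  lam_mem : ∀ (a : A) {x : A}, x ∈ I → lam a x ∈ I

/-- A homomorphism of skew braces. -/
structure IsBraceHom {A : Type u} {B : Type v} [SkewBrace A] [SkewBrace B] (f : A → B) : Prop where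
  map_dmul : ∀ x y : A, f (dmul x y) = dmul (f x) (f y)
  map_cmul : ∀ x y : A, f (cmul x y) = cmul (f x) (f y)

/-- The data of an isoclinism of skew braces along ideals `I` of `A` and `J` of `B`:
`ξ` induces a brace isomorphism `A/I → B/J` and `θ` restricts to a brace isomorphism
`Γ₂(A) → Γ₂(B)` compatible with the commutator and star maps. -/
structure IsoclinismData (A : Type u) (B : Type v) [SkewBrace A] [SkewBrace B]
    (I : Set A) (J : Set B) (ξ θ : A → B) : Prop where
  xi_resp : ∀ a a' : A, cosetRel I a a' ↔ cosetRel J (ξ a) (ξ a')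
  xi_surj : ∀ b : B, ∃ a : A, cosetRel J b (ξ a)
  xi_dmul : ∀ a a' : A, cosetRel J (dmul (ξ a) (ξ a')) (ξ (dmul a a'))
  xi_cmul : ∀ a a' : A, cosetRel J (cmul (ξ a) (ξ a')) (ξ (cmul a a'))
  theta_maps : ∀ x ∈ Gamma A 2, θ x ∈ Gamma B 2
  theta_inj : ∀ x ∈ Gamma A 2, ∀ y ∈ Gamma A 2, θ x = θ y → x = y
  theta_surj : ∀ y ∈ Gamma B 2, ∃ x ∈ Gamma A 2, θ x = y
  theta_dmul : ∀ x ∈ Gamma A 2, ∀ y ∈ Gamma A 2, θ (dmul x y) = dmul (θ x) (θ y)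
  theta_cmul : ∀ x ∈ Gamma A 2, ∀ y ∈ Gamma A 2, θ (cmul x y) = cmul (θ x) (θ y)
  compat_dcomm : ∀ a₁ a₂ : A, ∀ b₁ b₂ : B, cosetRel J b₁ (ξ a₁) → cosetRel J b₂ (ξ a₂) →
    θ (dcomm a₁ a₂) = dcomm b₁ b₂
  compat_star : ∀ a₁ a₂ : A, ∀ b₁ b₂ : B, cosetRel J b₁ (ξ a₁) → cosetRel J b₂ (ξ a₂) →
    θ (bstar a₁ a₂) = bstar b₁ b₂

/-- Isoclinism (1-isoclinism) of skew left braces. -/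
def Isoclinic (A : Type u) (B : Type v) [SkewBrace A] [SkewBrace B] : Prop :=
  ∃ ξ θ : A → B, IsoclinismData A B (AnnS A 1) (AnnS B 1) ξ θ

/-- The data of an `n`-isoclinism of skew braces: `ξ` induces a brace isomorphism
`A/Ann_n(A) → B/Ann_n(B)` and `θ` restricts to a brace isomorphism `A_{(n)} → B_{(n)}`
commuting with all brace commutator word maps of degree `n`. -/
structure IsoclinismDataN (A : Type u) (B : Type v) [SkewBrace A] [SkewBrace B]
    (n : ℕ) (ξ θ : A → B) : Prop where
  xi_resp : ∀ a a' : A, cosetRel (AnnS A n) a a' ↔ cosetRel (AnnS B n) (ξ a) (ξ a')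
  xi_surj : ∀ b : B, ∃ a : A, cosetRel (AnnS B n) b (ξ a)
  xi_dmul : ∀ a a' : A, cosetRel (AnnS B n) (dmul (ξ a) (ξ a')) (ξ (dmul a a'))
  xi_cmul : ∀ a a' : A, cosetRel (AnnS B n) (cmul (ξ a) (ξ a')) (ξ (cmul a a'))
  theta_maps : ∀ x ∈ Asub A n, θ x ∈ Asub B n
  theta_inj : ∀ x ∈ Asub A n, ∀ y ∈ Asub A n, θ x = θ y → x = y
  theta_surj : ∀ y ∈ Asub B n, ∃ x ∈ Asub A n, θ x = y
  theta_dmul : ∀ x ∈ Asub A n, ∀ y ∈ Asub A n, θ (dmul x y) = dmul (θ x) (θ y)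
  theta_cmul : ∀ x ∈ Asub A n, ∀ y ∈ Asub A n, θ (cmul x y) = cmul (θ x) (θ y)
  compat : ∀ (e : ℕ → BWord) (a : ℕ → A) (b : ℕ → B),
    (∀ i : ℕ, i ≤ n → cosetRel (AnnS B n) (b i) (ξ (a i))) →
    θ (evalW e a n) = evalW e b n

/-- `n`-isoclinism of skew left braces. -/
def IsoclinicN (A : Type u) (B : Type v) [SkewBrace A] [SkewBrace B] (n : ℕ) : Prop :=
  ∃ ξ θ : A → B, IsoclinismDataN A B n ξ θ

/-- The product set `S · T = {s · t : s ∈ S, t ∈ T}` in `(A,·)`. -/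
def setDProd (S T : Set A) : Set A := {x | ∃ s ∈ S, ∃ t ∈ T, x = dmul s t}

/-- The product set `S ∘ T = {s ∘ t : s ∈ S, t ∈ T}` in `(A,∘)`. -/
def setCProd (S T : Set A) : Set A := {x | ∃ s ∈ S, ∃ t ∈ T, x = cmul s t}

/-- The skew brace structure on a sub-skew brace. -/
def subBrace (S : Set A) (h : IsSubBrace A S) : SkewBrace S where
  dmul x y := ⟨dmul x.1 y.1, h.dmul_mem x.2 y.2⟩
  ident := ⟨ident, h.ident_mem⟩
  dinv x := ⟨dinv x.1, h.dinv_mem x.2⟩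
  cmul x y := ⟨cmul x.1 y.1, h.cmul_mem x.2 y.2⟩
  cinv x := ⟨cinv x.1, h.cinv_mem x.2⟩
  dmul_assoc a b c := Subtype.ext (dmul_assoc a.1 b.1 c.1)
  ident_dmul a := Subtype.ext (ident_dmul a.1)
  dmul_ident a := Subtype.ext (dmul_ident a.1)
  dinv_dmul a := Subtype.ext (dinv_dmul a.1)
  dmul_dinv a := Subtype.ext (dmul_dinv a.1)
  cmul_assoc a b c := Subtype.ext (cmul_assoc a.1 b.1 c.1)
  ident_cmul a := Subtype.ext (ident_cmul a.1)
  cmul_ident a := Subtype.ext (cmul_ident a.1)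
  cinv_cmul a := Subtype.ext (cinv_cmul a.1)
  cmul_cinv a := Subtype.ext (cmul_cinv a.1)
  compat a b c := Subtype.ext (compat a.1 b.1 c.1)

/-- The direct product of two skew braces, with componentwise operations. -/
instance prodBrace (A : Type u) (B : Type v) [SkewBrace A] [SkewBrace B] :
    SkewBrace (A × B) where
  dmul p q := (dmul p.1 q.1, dmul p.2 q.2)
  ident := (ident, ident)
  dinv p := (dinv p.1, dinv p.2)
  cmul p q := (cmul p.1 q.1, cmul p.2 q.2)
  cinv p := (cinv p.1, cinv p.2)
  dmul_assoc a b c := Prod.ext_iff.mpr ⟨dmul_assoc _ _ _, dmul_assoc _ _ _⟩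
  ident_dmul a := Prod.ext_iff.mpr ⟨ident_dmul _, ident_dmul _⟩
  dmul_ident a := Prod.ext_iff.mpr ⟨dmul_ident _, dmul_ident _⟩
  dinv_dmul a := Prod.ext_iff.mpr ⟨dinv_dmul _, dinv_dmul _⟩
  dmul_dinv a := Prod.ext_iff.mpr ⟨dmul_dinv _, dmul_dinv _⟩
  cmul_assoc a b c := Prod.ext_iff.mpr ⟨cmul_assoc _ _ _, cmul_assoc _ _ _⟩
  ident_cmul a := Prod.ext_iff.mpr ⟨ident_cmul _, ident_cmul _⟩
  cmul_ident a := Prod.ext_iff.mpr ⟨cmul_ident _, cmul_ident _⟩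
  cinv_cmul a := Prod.ext_iff.mpr ⟨cinv_cmul _, cinv_cmul _⟩
  cmul_cinv a := Prod.ext_iff.mpr ⟨cmul_cinv _, cmul_cinv _⟩
  compat a b c := Prod.ext_iff.mpr ⟨compat _ _ _, compat _ _ _⟩

end SkewBrace

open scoped commutatorElement

namespace Subgroup

variable {G : Type*} [Group G]

theorem commutator_le_iff_map_mk_eq_bot (N : Subgroup G) [N.Normal] (H K : Subgroup G) :
    ⁅H, K⁆ ≤ N ↔ ⁅H.map (QuotientGroup.mk' N), K.map (QuotientGroup.mk' N)⁆ = ⊥ := by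
  rw [← map_commutator, map_eq_bot_iff, QuotientGroup.ker_mk']

/-- The three subgroups lemma modulo a normal subgroup. -/
theorem commutator_commutator_le_of_rotate (N : Subgroup G) [N.Normal] {H₁ H₂ H₃ : Subgroup G}
    (h₁ : ⁅⁅H₂, H₃⁆, H₁⁆ ≤ N) (h₂ : ⁅⁅H₃, H₁⁆, H₂⁆ ≤ N) : ⁅⁅H₁, H₂⁆, H₃⁆ ≤ N := by
  rw [commutator_le_iff_map_mk_eq_bot, map_commutator] at *
  exact commutator_commutator_eq_bot_of_rotate h₁ h₂

theorem commutator_lowerCentralSeries_upperCentralSeries_le (k m : ℕ) :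
    ⁅(⊤ : Subgroup G).lowerCentralSeries k, upperCentralSeries G (m + k + 1)⁆ ≤
      upperCentralSeries G m := by
  induction k generalizing m with
  | zero =>
    rw [commutator_comm]
    exact commutator_upperCentralSeries_top_le G m
  | succ k ih =>
    rw [lowerCentralSeries_succ]
    refine commutator_commutator_le_of_rotate _ ?_ ?_
    · rw [commutator_comm ⊤, commutator_comm]
      exact (commutator_mono le_rfl (commutator_upperCentralSeries_top_le G (m + k + 1))).trans
        (ih m)
    · rw [commutator_comm (upperCentralSeries G _)]
      refine (commutator_mono ?_ le_rfl).trans (commutator_upperCentralSeries_top_le G m)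
      convert ih (m + 1) using 3
      omega

theorem commutatorElement_mem_upperCentralSeries {k m : ℕ} {z w : G}
    (hz : z ∈ upperCentralSeries G (m + k + 1))
    (hw : w ∈ (⊤ : Subgroup G).lowerCentralSeries k) : ⁅z, w⁆ ∈ upperCentralSeries G m :=
  commutator_lowerCentralSeries_upperCentralSeries_le k m
    (commutator_comm_le _ _ (commutator_mem_commutator hz hw))

theorem mk_commutatorElement_congr {k m : ℕ} {g g' w w' : G}
    (hg : (g : G ⧸ upperCentralSeries G (m + k + 1)) = g')
    (hw : (w : G ⧸ upperCentralSeries G (m + 1)) = w')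
    (hk : w ∈ (⊤ : Subgroup G).lowerCentralSeries k) :
    ((⁅g, w⁆ : G) : G ⧸ upperCentralSeries G m) = (⁅g', w'⁆ : G) := by
  obtain ⟨c, hc, rfl⟩ : ∃ c ∈ upperCentralSeries G (m + k + 1), g' = g * c :=
    ⟨g⁻¹ * g', QuotientGroup.eq.mp hg, by group⟩
  obtain ⟨d, hd, rfl⟩ : ∃ d ∈ upperCentralSeries G (m + 1), w' = w * d :=
    ⟨w⁻¹ * w', QuotientGroup.eq.mp hw, by group⟩
  have key {x y : G} (hxy : ⁅x, y⁆ ∈ upperCentralSeries G m) :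
      Commute (x : G ⧸ upperCentralSeries G m) y := by
    rw [commute_iff_eq, ← commutatorElement_eq_one_iff_mul_comm]
    exact (QuotientGroup.eq_one_iff _).mpr hxy
  have hcw := key (commutatorElement_mem_upperCentralSeries hc hk)
  have hdx (x : G) := key (hd x)
  have h₁ := (hdx (g * c)).symm.eq
  simp only [commutatorElement_def, QuotientGroup.mk_mul, QuotientGroup.mk_inv] at *
  generalize (g : G ⧸ upperCentralSeries G m) = g at *
  generalize (w : G ⧸ upperCentralSeries G m) = w at *
  generalize (c : G ⧸ upperCentralSeries G m) = c at *
  generalize (d : G ⧸ upperCentralSeries G m) = d at *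
  symm
  calc g * c * (w * d) * (g * c)⁻¹ * (w * d)⁻¹
      = g * c * w * (d * (g * c)⁻¹) * d⁻¹ * w⁻¹ := by group
    _ = g * c * w * ((g * c)⁻¹ * d) * d⁻¹ * w⁻¹ := by
        rw [(show Commute (g * c) d from h₁).inv_left.eq]
    _ = g * (c * w) * c⁻¹ * g⁻¹ * w⁻¹ := by group
    _ = g * (w * c) * c⁻¹ * g⁻¹ * w⁻¹ := by rw [hcw.eq]
    _ = g * w * g⁻¹ * w⁻¹ := by group

theorem mk_commutatorElement_congr_right {k m : ℕ} {g g' w w' : G}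
    (hg : (g : G ⧸ upperCentralSeries G (m + k + 1)) = g')
    (hw : (w : G ⧸ upperCentralSeries G (m + 1)) = w')
    (hk : w ∈ (⊤ : Subgroup G).lowerCentralSeries k) :
    ((⁅w, g⁆ : G) : G ⧸ upperCentralSeries G m) = (⁅w', g'⁆ : G) := by
  rw [← commutatorElement_inv g w, ← commutatorElement_inv g' w', QuotientGroup.mk_inv,
    QuotientGroup.mk_inv, mk_commutatorElement_congr hg hw hk]

end Subgroup

namespace SkewBrace

open Subgroup

/-- The group `(A,·)` underlying a skew left brace. -/
instance dotGroup (A : Type*) [SkewBrace A] : Group A where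
  mul := dmul
  one := ident
  inv := dinv
  mul_assoc := dmul_assoc
  one_mul := ident_dmul
  mul_one := dmul_ident
  inv_mul_cancel := dinv_dmul

section Lambda

variable {A : Type*} [SkewBrace A]

theorem ident_eq_one : (ident : A) = 1 := rfl

theorem lam_eq (a b : A) : lam a b = a⁻¹ * cmul a b := rfl

theorem bstar_eq (a b : A) : bstar a b = lam a b * b⁻¹ := rfl

theorem cmul_eq (a b : A) : cmul a b = a * lam a b := by
  rw [lam_eq, mul_inv_cancel_left]

theorem cmul_mul (a b c : A) : cmul a (b * c) = cmul a b * a⁻¹ * cmul a c := compat a b c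

theorem lam_mul (a b c : A) : lam a (b * c) = lam a b * lam a c := by
  simp only [lam_eq, cmul_mul, mul_assoc]

theorem lam_one (a : A) : lam a 1 = 1 := by
  simpa using lam_mul a 1 1

theorem lam_inv (a b : A) : lam a b⁻¹ = (lam a b)⁻¹ := by
  rw [eq_inv_iff_mul_eq_one, ← lam_mul, inv_mul_cancel, lam_one]

theorem lam_cmul (a b c : A) : lam (cmul a b) c = lam a (lam b c) := by
  have h : lam a (cmul b c) = lam a b * lam a (lam b c) := by rw [cmul_eq b, lam_mul]
  rw [lam_eq a (cmul b c), ← cmul_assoc, cmul_eq (cmul a b), cmul_eq a b] at h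
  rw [cmul_eq a b]
  simpa [mul_assoc] using h

theorem lam_ident (b : A) : lam 1 b = b := by
  simpa [ident_eq_one] using (cmul_eq ident b).symm.trans (ident_cmul b)

/-- The automorphism `λ_a` of `(A,·)`. -/
def lamAut (a : A) : MulAut A where
  toFun := lam a
  invFun := lam (cinv a)
  left_inv b := by rw [← lam_cmul, cinv_cmul, ident_eq_one, lam_ident]
  right_inv b := by rw [← lam_cmul, cmul_cinv, ident_eq_one, lam_ident]
  map_mul' := lam_mul a

theorem lamAut_apply (a b : A) : lamAut a b = lam a b := rfl

theorem lamAut_cmul (a b : A) : lamAut (cmul a b) = lamAut a * lamAut b :=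
  MulEquiv.ext (lam_cmul a b)

theorem IsSymmetric.lamAut_mul (h : IsSymmetric A) (a b : A) :
    lamAut (a * b) = lamAut b * lamAut a := by
  ext y
  have h₁ : a * cmul b (lam a y) = cmul (cmul (a * b) (cinv a)) (a * lam a y) := h a b (lam a y)
  rw [← cmul_eq a y, cmul_assoc, ← cmul_assoc (cinv a), cinv_cmul, ident_cmul, cmul_eq b,
    cmul_eq (a * b), ← mul_assoc] at h₁
  exact (mul_left_cancel h₁).symm

theorem IsSymmetric.lamAut_lam (h : IsSymmetric A) (a b : A) :
    lamAut (lam a b) = lamAut a * lamAut b * (lamAut a)⁻¹ := by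
  rw [eq_mul_inv_iff_mul_eq, ← h.lamAut_mul, ← cmul_eq, lamAut_cmul]

/-- For a symmetric skew left brace, `a ↦ λ_a⁻¹` is a homomorphism on `(A,·)`. -/
def IsSymmetric.lamInvHom (h : IsSymmetric A) : A →* MulAut A where
  toFun a := (lamAut a)⁻¹
  map_one' := inv_eq_one.mpr (MulEquiv.ext lam_ident)
  map_mul' a b := by rw [h.lamAut_mul, mul_inv_rev]

theorem IsSymmetric.lamInvHom_apply (h : IsSymmetric A) (a : A) :
    h.lamInvHom a = (lamAut a)⁻¹ := rfl

end Lambda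

/-- A representation of a skew left brace in a group in which both the dot commutator and the star
operation become commutators: think of `L a` as left translation by `a` and of `R a` as `λ_a⁻¹`. -/
structure CommutatorRep (A : Type*) [SkewBrace A] (H : Type*) [Group H] where
  L : A →* H
  R : A →* H
  L_injective : Function.Injective L
  L_bstar : ∀ a b : A, L (bstar a b) = ⁅(R a)⁻¹, L b⁆
  R_bstar : ∀ a b : A, R (bstar a b) = ⁅(R a)⁻¹, R b⁆
  exists_eq_mul : ∀ g : H, ∃ a b : A, g = L a * R b

/-- The representation of a symmetric skew left brace in the semidirect product of `(A,·)` with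
its group of lambda maps. -/
def IsSymmetric.commutatorRep {A : Type*} [SkewBrace A] (h : IsSymmetric A) :
    CommutatorRep A (A ⋊[h.lamInvHom.range.subtype] h.lamInvHom.range) where
  L := SemidirectProduct.inl
  R := SemidirectProduct.inr.comp h.lamInvHom.rangeRestrict
  L_injective := SemidirectProduct.inl_injective
  L_bstar a b := by
    rw [commutatorElement_def, inv_inv, MonoidHom.comp_apply, ← map_inv SemidirectProduct.inr,
      bstar_eq, map_mul, map_inv]
    congr 1
    have := SemidirectProduct.inl_aut (φ := h.lamInvHom.range.subtype)
      (h.lamInvHom.rangeRestrict a)⁻¹ b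
    rw [map_inv SemidirectProduct.inr, inv_inv] at this
    rw [map_inv, ← this]
    simp [h.lamInvHom_apply, lamAut_apply]
  R_bstar a b := by
    simp only [MonoidHom.comp_apply, ← map_inv SemidirectProduct.inr, ← map_commutatorElement]
    congr 1
    ext1
    simp [bstar_eq, commutatorElement_def, h.lamInvHom_apply, h.lamAut_lam, mul_assoc]
  exists_eq_mul g := by
    obtain ⟨x, _, b, rfl⟩ := g
    exact ⟨x, b, SemidirectProduct.mk_eq_inl_mul_inr _ _⟩

namespace CommutatorRep

variable {A : Type*} [SkewBrace A] {H : Type*} [Group H] (ρ : CommutatorRep A H)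

theorem L_dcomm (a b : A) : ρ.L (dcomm a b) = ⁅ρ.L a, ρ.L b⁆ :=
  map_commutatorElement ρ.L a b

theorem R_dcomm (a b : A) : ρ.R (dcomm a b) = ⁅ρ.R a, ρ.R b⁆ :=
  map_commutatorElement ρ.R a b

/-- The elements of `A` both of whose images lie in the `n`-th term of the upper central series. -/
def upper (n : ℕ) : Subgroup A :=
  (Subgroup.upperCentralSeries H n).comap ρ.L ⊓ (Subgroup.upperCentralSeries H n).comap ρ.R

/-- The elements of `A` both of whose images lie in the `k`-th term of the lower central series. -/
def lower (k : ℕ) : Subgroup A :=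
  ((⊤ : Subgroup H).lowerCentralSeries k).comap ρ.L ⊓
    ((⊤ : Subgroup H).lowerCentralSeries k).comap ρ.R

theorem mem_lower_zero (a : A) : a ∈ ρ.lower 0 := ⟨mem_top _, mem_top _⟩

theorem evalX_mem_upper (ε : BWord) {m k : ℕ} {x v : A} (hx : x ∈ ρ.upper (m + k + 1))
    (hv : v ∈ ρ.lower k) : evalX ε x v ∈ ρ.upper m := by
  have key {z w : H} (hz : z ∈ Subgroup.upperCentralSeries H (m + k + 1))
      (hw : w ∈ (⊤ : Subgroup H).lowerCentralSeries k) :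
      ⁅z, w⁆ ∈ Subgroup.upperCentralSeries H m ∧ ⁅w, z⁆ ∈ Subgroup.upperCentralSeries H m :=
    ⟨commutatorElement_mem_upperCentralSeries hz hw, by
      rw [← commutatorElement_inv]
      exact inv_mem (commutatorElement_mem_upperCentralSeries hz hw)⟩
  obtain ⟨hxL, hxR⟩ := hx
  obtain ⟨hvL, hvR⟩ := hv
  refine mem_inf.mpr ⟨mem_comap.mpr ?_, mem_comap.mpr ?_⟩ <;> cases ε <;>
    simp only [evalX, L_dcomm, R_dcomm, L_bstar, R_bstar]
  · exact (key hxL hvL).1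
  · exact (key hxL hvL).2
  · exact (key (inv_mem hxR) hvL).1
  · exact (key hxL (inv_mem hvR)).2
  · exact (key hxR hvR).1
  · exact (key hxR hvR).2
  · exact (key (inv_mem hxR) hvR).1
  · exact (key hxR (inv_mem hvR)).2

theorem evalX_mem_lower (ε : BWord) {k : ℕ} (u : A) {v : A} (hv : v ∈ ρ.lower k) :
    evalX ε u v ∈ ρ.lower (k + 1) := by
  have key (z : H) {w : H} (hw : w ∈ (⊤ : Subgroup H).lowerCentralSeries k) :
      ⁅z, w⁆ ∈ (⊤ : Subgroup H).lowerCentralSeries (k + 1) ∧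
        ⁅w, z⁆ ∈ (⊤ : Subgroup H).lowerCentralSeries (k + 1) :=
    ⟨commutator_comm_le _ _ (commutator_mem_commutator (mem_top z) hw),
      commutator_mem_commutator hw (mem_top z)⟩
  obtain ⟨hvL, hvR⟩ := hv
  refine mem_inf.mpr ⟨mem_comap.mpr ?_, mem_comap.mpr ?_⟩ <;> cases ε <;>
    simp only [evalX, L_dcomm, R_dcomm, L_bstar, R_bstar]
  · exact (key _ hvL).1
  · exact (key _ hvL).2
  · exact (key _ hvL).1
  · exact (key _ (inv_mem hvR)).2
  · exact (key _ hvR).1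
  · exact (key _ hvR).2
  · exact (key _ hvR).1
  · exact (key _ (inv_mem hvR)).2

theorem mem_upperCentralSeries_succ {n : ℕ} {z : H}
    (hL : ∀ a, ⁅z, ρ.L a⁆ ∈ Subgroup.upperCentralSeries H n)
    (hR : ∀ a, ⁅z, ρ.R a⁆ ∈ Subgroup.upperCentralSeries H n) : z ∈ Subgroup.upperCentralSeries H (n + 1) := by
  rw [Subgroup.mem_upperCentralSeries_succ_iff]
  intro g
  obtain ⟨a, b, rfl⟩ := ρ.exists_eq_mul g
  have h : ⁅z, ρ.L a * ρ.R b⁆ = ⁅z, ρ.L a⁆ * (ρ.L a * ⁅z, ρ.R b⁆ * (ρ.L a)⁻¹) := by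
    simp only [commutatorElement_def]
    group
  rw [h]
  exact mul_mem (hL a) (Normal.conj_mem inferInstance _ (hR b) _)

theorem mem_AnnS_iff (n : ℕ) (x : A) : x ∈ AnnS A n ↔ x ∈ ρ.upper n := by
  induction n generalizing x with
  | zero =>
    constructor
    · rintro rfl
      exact one_mem _
    · rintro ⟨hx, -⟩
      exact ρ.L_injective (hx.trans (map_one ρ.L).symm)
  | succ n ih =>
    constructor
    · intro hx
      replace hx (b : A) : bstar x b ∈ ρ.upper n ∧ bstar b x ∈ ρ.upper n ∧
          dcomm x b ∈ ρ.upper n := by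
        simpa only [ih] using hx b
      constructor
      · refine ρ.mem_upperCentralSeries_succ (fun a => ?_) (fun a => ?_)
        · rw [← L_dcomm]
          exact (hx a).2.2.1
        · rw [← commutatorElement_inv, inv_mem_iff, ← inv_inv (ρ.R a), ← map_inv, ← L_bstar]
          exact (hx a⁻¹).2.1.1
      · refine (inv_mem_iff (x := ρ.R x)).mp (ρ.mem_upperCentralSeries_succ (fun a => ?_) (fun a => ?_))
        · rw [← L_bstar]
          exact (hx a).1.1
        · rw [← R_bstar]
          exact (hx a).1.2
    · intro hx b
      simp only [ih]
      exact ⟨ρ.evalX_mem_upper (m := n) (k := 0) .s hx (ρ.mem_lower_zero b),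
        ρ.evalX_mem_upper (m := n) (k := 0) .sbar hx (ρ.mem_lower_zero b),
        ρ.evalX_mem_upper (m := n) (k := 0) .g hx (ρ.mem_lower_zero b)⟩

theorem Gamma_subset_lower (k : ℕ) : Gamma A (k + 1) ⊆ ρ.lower k := by
  induction k with
  | zero => exact fun a _ => ρ.mem_lower_zero a
  | succ k ih =>
    intro v hv
    induction (show dclosure _ v from hv) with
    | mem hx =>
      obtain (⟨a, -, w, hw, rfl⟩ | ⟨w, hw, a, -, rfl⟩) | ⟨a, -, w, hw, rfl⟩ := hx
      · exact ρ.evalX_mem_lower .s a (ih hw)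
      · exact ρ.evalX_mem_lower .sbar a (ih hw)
      · exact ρ.evalX_mem_lower .g a (ih hw)
    | one => exact one_mem _
    | mul hx hy ihx ihy => exact mul_mem (ihx hx) (ihy hy)
    | inv hx ihx => exact inv_mem (ihx hx)

theorem evalW_mem_lower (e : ℕ → BWord) (a : ℕ → A) (k : ℕ) : evalW e a k ∈ ρ.lower k := by
  induction k generalizing e a with
  | zero => exact ρ.mem_lower_zero _
  | succ k ih => exact ρ.evalX_mem_lower _ _ (ih _ _)

/-- Both images of `x` and `y` agree modulo the `n`-th term of the upper central series. -/
def Congr (n : ℕ) (x y : A) : Prop :=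
  (ρ.L x : H ⧸ Subgroup.upperCentralSeries H n) = ρ.L y ∧ (ρ.R x : H ⧸ Subgroup.upperCentralSeries H n) = ρ.R y

theorem congr_mul_left {n : ℕ} {c : A} (hc : c ∈ ρ.upper n) (x : A) : ρ.Congr n x (c * x) := by
  have h₁ : (ρ.L c : H ⧸ Subgroup.upperCentralSeries H n) = 1 := (QuotientGroup.eq_one_iff _).mpr hc.1
  have h₂ : (ρ.R c : H ⧸ Subgroup.upperCentralSeries H n) = 1 := (QuotientGroup.eq_one_iff _).mpr hc.2
  constructor
  · rw [map_mul, QuotientGroup.mk_mul, h₁, one_mul]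
  · rw [map_mul, QuotientGroup.mk_mul, h₂, one_mul]

theorem Congr.evalX {ρ : CommutatorRep A H} (ε : BWord) {m k : ℕ} {u u' w w' : A}
    (hu : ρ.Congr (m + k + 1) u u') (hw : ρ.Congr (m + 1) w w') (hk : w ∈ ρ.lower k) :
    ρ.Congr m (evalX ε u w) (evalX ε u' w') := by
  have mk_inv_congr {n : ℕ} {g g' : H} (hg : (g : H ⧸ Subgroup.upperCentralSeries H n) = g') :
      ((g⁻¹ : H) : H ⧸ Subgroup.upperCentralSeries H n) = (g'⁻¹ : H) := by
    rw [QuotientGroup.mk_inv, hg, QuotientGroup.mk_inv]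
  obtain ⟨huL, huR⟩ := hu
  obtain ⟨hwL, hwR⟩ := hw
  obtain ⟨hkL, hkR⟩ := hk
  constructor <;> cases ε <;> simp only [SkewBrace.evalX, L_dcomm, R_dcomm, L_bstar, R_bstar]
  · exact mk_commutatorElement_congr huL hwL hkL
  · exact mk_commutatorElement_congr_right huL hwL hkL
  · exact mk_commutatorElement_congr (mk_inv_congr huR) hwL hkL
  · exact mk_commutatorElement_congr_right huL (mk_inv_congr hwR) (inv_mem hkR)
  · exact mk_commutatorElement_congr huR hwR hkR
  · exact mk_commutatorElement_congr_right huR hwR hkR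
  · exact mk_commutatorElement_congr (mk_inv_congr huR) hwR hkR
  · exact mk_commutatorElement_congr_right huR (mk_inv_congr hwR) (inv_mem hkR)

theorem congr_evalW {k m : ℕ} (e : ℕ → BWord) {a b : ℕ → A}
    (hab : ∀ i ≤ k, ρ.Congr (m + k) (a i) (b i)) :
    ρ.Congr m (evalW e a k) (evalW e b k) := by
  induction k generalizing m e a b with
  | zero => exact hab 0 le_rfl
  | succ k ih =>
    refine Congr.evalX (k := k) (e 0) (hab 0 (Nat.zero_le _)) (ih _ fun i hi => ?_)
      (ρ.evalW_mem_lower _ _ _)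
    rw [add_right_comm]
    exact hab (i + 1) (Nat.succ_le_succ hi)

theorem Congr.eq_of_zero {ρ : CommutatorRep A H} {x y : A} (h : ρ.Congr 0 x y) : x = y :=
  ρ.L_injective (inv_mul_eq_one.mp (mem_bot.mp (QuotientGroup.eq.mp h.1)))

theorem inClass (ρ : CommutatorRep A H) (n : ℕ) : InClass A n := by
  intro e a b hab
  refine (Congr.eq_of_zero (ρ := ρ) (ρ.congr_evalW e fun i hi => ?_)).symm
  obtain ⟨c, hc, hb⟩ := hab i hi
  rw [hb, zero_add]
  exact ρ.congr_mul_left ((ρ.mem_AnnS_iff n c).mp hc) (a i)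

end CommutatorRep

end SkewBrace

open SkewBrace in
/-- Let `A` be a symmetric skew brace. Then `ε(x,v) ∈ Ann_{s-r}(A)` for all `ε ∈ X`, all
`s ≥ r ≥ 1`, all `x ∈ Ann_s(A)` and all `v ∈ Γ_r(A)`; consequently `A` belongs to the class
`I_n` for every `n ≥ 1`. -/
theorem symmetric_mem_inClass (A : Type u) [SkewBrace A] (h : IsSymmetric A) :
    (∀ (ε : BWord) (s r : ℕ), 1 ≤ r → r ≤ s →
      ∀ x ∈ AnnS A s, ∀ v ∈ Gamma A r, evalX ε x v ∈ AnnS A (s - r)) ∧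
    (∀ n : ℕ, 1 ≤ n → InClass A n) := by
  refine ⟨fun ε s r hr hrs x hx v hv => ?_, fun n _ => h.commutatorRep.inClass n⟩
  obtain ⟨k, rfl⟩ := Nat.exists_eq_add_of_le' hr
  obtain ⟨m, rfl⟩ := Nat.exists_eq_add_of_le' hrs
  rw [Nat.add_sub_cancel, h.commutatorRep.mem_AnnS_iff]
  rw [h.commutatorRep.mem_AnnS_iff] at hx
  exact h.commutatorRep.evalX_mem_upper ε hx (h.commutatorRep.Gamma_subset_lower k hv)
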